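/- arXiv:1704.05434 — 8 statements merged into one kernel-verified Lean document; each statement's English description precedes it below -/
import Mathlib

section
/- Let L be the Laplacian matrix of a weighted undirected graph on n vertices. For all x, e ∈ ℝⁿ, one has −xᵀL(x + e) ≤ −(1/2) Σᵢ₌₁ⁿ qᵢ(x) + Σᵢ₌₁ⁿ Lᵢᵢ eᵢ², where qᵢ(x) = −(1/2) Σⱼ₌₁ⁿ Lᵢⱼ (xⱼ − xᵢ)². -/
open Matrix BigOperators

/-- Key estimate (8) in the continuous approach:
`−xᵀL(x + e) ≤ −(1/2) Σᵢ qᵢ(x) + Σᵢ Lᵢᵢ eᵢ²`. -/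
theorem dV_upper_bound_continuous
    (n : ℕ) (hn : 1 ≤ n)
    (A : Matrix (Fin n) (Fin n) ℝ)
    (hAsymm : A.IsSymm)
    (hAnonneg : ∀ i j, 0 ≤ A i j)
    (hAdiag : ∀ i, A i i = 0)
    (L : Matrix (Fin n) (Fin n) ℝ)
    (hL : L = Matrix.diagonal (fun i => ∑ j, A i j) - A)
    (x e : Fin n → ℝ)
    (q : Fin n → ℝ)
    (hq : ∀ i, q i = -(1/2) * ∑ j, L i j * (x j - x i)^2) :
    -(x ⬝ᵥ L.mulVec (x + e)) ≤ -(1/2) * ∑ i, q i + ∑ i, L i i * (e i)^2 := by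
  have hs : ∀ i j, A i j = A j i := fun i j => hAsymm.apply j i
  have hrow : ∀ y : Fin n → ℝ, x ⬝ᵥ L.mulVec y = ∑ i, ∑ j, A i j * (x i * (y i - y j)) := by
    intro y
    rw [hL, Matrix.sub_mulVec]
    simp only [dotProduct, Pi.sub_apply, Matrix.mulVec_diagonal]
    refine Finset.sum_congr rfl fun i _ => ?_
    simp only [Matrix.mulVec, dotProduct]
    rw [Finset.sum_mul, ← Finset.sum_sub_distrib, Finset.mul_sum]
    refine Finset.sum_congr rfl fun j _ => ?_
    ring
  have hq' : ∀ i, q i = ∑ j, A i j * ((1/2) * (x j - x i)^2) := by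
    intro i
    rw [hq, Finset.mul_sum]
    refine Finset.sum_congr rfl fun j _ => ?_
    rw [hL]
    by_cases h : i = j
    · subst h; simp
    · simp [Matrix.diagonal_apply_ne _ h]; ring
  have hd : ∀ i, L i i * (e i)^2 = ∑ j, A i j * (e i)^2 := by
    intro i
    rw [hL]
    simp [hAdiag, Finset.sum_mul]
  have h1 : ∑ i, ∑ j, A i j * (x i)^2 = ∑ i, ∑ j, A i j * (x j)^2 := by
    rw [Finset.sum_comm]
    exact Finset.sum_congr rfl fun i _ => Finset.sum_congr rfl fun j _ => by rw [hs]
  have h2 : ∑ i, ∑ j, A i j * (x i * e j) = ∑ i, ∑ j, A i j * (x j * e i) := by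
    rw [Finset.sum_comm]
    exact Finset.sum_congr rfl fun i _ => Finset.sum_congr rfl fun j _ => by rw [hs]
  have h3 : 0 ≤ ∑ i, ∑ j, A i j * ((x i - x j) / 2 + e i)^2 :=
    Finset.sum_nonneg fun i _ => Finset.sum_nonneg fun j _ =>
      mul_nonneg (hAnonneg i j) (sq_nonneg _)
  have key : (-(1/2) * ∑ i, q i + ∑ i, L i i * (e i)^2) + x ⬝ᵥ L.mulVec (x + e)
      = ∑ i, ∑ j, A i j * ((x i - x j) / 2 + e i)^2
        + (1/2) * (∑ i, ∑ j, A i j * (x i)^2 - ∑ i, ∑ j, A i j * (x j)^2)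
        - (∑ i, ∑ j, A i j * (x i * e j) - ∑ i, ∑ j, A i j * (x j * e i)) := by
    rw [hrow]
    simp only [hq', hd, Finset.mul_sum, ← Finset.sum_add_distrib, ← Finset.sum_sub_distrib,
      Pi.add_apply]
    refine Finset.sum_congr rfl fun i _ => Finset.sum_congr rfl fun j _ => ?_
    ring
  rw [h1, h2] at key
  linarith
end

section
/- Let L be the Laplacian matrix of a connected weighted undirected graph on n ≥ 2 vertices and let ρ₂(L) be its smallest positive eigenvalue. Let σ₁,…,σₙ ∈ (0,1) with σ_max = maxᵢ σᵢ. If x, e ∈ ℝⁿ satisfy Lᵢᵢ eᵢ² ≤ (σᵢ/2) qᵢ(x) for every i, where qᵢ(x) = −(1/2) Σⱼ Lᵢⱼ (xⱼ − xᵢ)², then −xᵀL(x + e) ≤ −(1 − σ_max) ρ₂(L) · (1/2) xᵀKₙx. -/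
open Matrix BigOperators

lemma aux_mulVec {n : ℕ} (A L : Matrix (Fin n) (Fin n) ℝ)
    (hL : L = Matrix.diagonal (fun i => ∑ j, A i j) - A) (v : Fin n → ℝ) (i : Fin n) :
    L.mulVec v i = ∑ j, A i j * (v i - v j) := by
  subst hL
  rw [Matrix.sub_mulVec, Pi.sub_apply, Matrix.mulVec_diagonal, Finset.sum_mul]
  simp only [Matrix.mulVec, dotProduct, mul_sub, Finset.sum_sub_distrib]

lemma aux_swap {n : ℕ} (A : Matrix (Fin n) (Fin n) ℝ) (hA : A.IsSymm) (f : Fin n → Fin n → ℝ) :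
    ∑ i, ∑ j, A i j * f i j = ∑ i, ∑ j, A i j * f j i := by
  rw [Finset.sum_comm]
  refine Finset.sum_congr rfl fun i _ => Finset.sum_congr rfl fun j _ => ?_
  rw [hA.apply]

lemma aux_bil {n : ℕ} (A L : Matrix (Fin n) (Fin n) ℝ) (hA : A.IsSymm)
    (hL : L = Matrix.diagonal (fun i => ∑ j, A i j) - A) (v w : Fin n → ℝ) :
    v ⬝ᵥ L.mulVec w = (1/2) * ∑ i, ∑ j, A i j * ((v i - v j) * (w i - w j)) := by
  have h1 : v ⬝ᵥ L.mulVec w = ∑ i, ∑ j, A i j * (v i * (w i - w j)) := by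
    simp only [dotProduct, aux_mulVec A L hL, Finset.mul_sum]
    refine Finset.sum_congr rfl fun i _ => Finset.sum_congr rfl fun j _ => ?_
    ring
  have h2 := aux_swap A hA (fun i j => v i * (w i - w j))
  have h3 : ∑ i, ∑ j, A i j * ((v i - v j) * (w i - w j))
      = ∑ i, ∑ j, A i j * (v i * (w i - w j)) + ∑ i, ∑ j, A i j * (v j * (w j - w i)) := by
    simp only [← Finset.sum_add_distrib]
    refine Finset.sum_congr rfl fun i _ => Finset.sum_congr rfl fun j _ => ?_
    ring
  rw [h3, ← h2, h1]; ring

lemma aux_const {n : ℕ} (A L : Matrix (Fin n) (Fin n) ℝ) (hA : A.IsSymm)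
    (hAnonneg : ∀ i j, 0 ≤ A i j)
    (hconn : (SimpleGraph.fromRel (fun i j => 0 < A i j)).Connected)
    (hL : L = Matrix.diagonal (fun i => ∑ j, A i j) - A) (v : Fin n → ℝ)
    (hv : L.mulVec v = 0) (i j : Fin n) : v i = v j := by
  have h0 := aux_bil A L hA hL v v
  rw [hv, dotProduct_zero] at h0
  have hnn : ∀ i j, 0 ≤ A i j * ((v i - v j) * (v i - v j)) := fun i j =>
    mul_nonneg (hAnonneg i j) (mul_self_nonneg _)
  have h1 : ∑ i, ∑ j, A i j * ((v i - v j) * (v i - v j)) = 0 := by linarith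
  have h2 : ∀ i j, A i j * ((v i - v j) * (v i - v j)) = 0 := by
    intro i j
    rw [Finset.sum_eq_zero_iff_of_nonneg
      (fun i _ => Finset.sum_nonneg fun j _ => hnn i j)] at h1
    have h3 := h1 i (Finset.mem_univ _)
    rw [Finset.sum_eq_zero_iff_of_nonneg (fun j _ => hnn i j)] at h3
    exact h3 j (Finset.mem_univ _)
  have hpos : ∀ i j, 0 < A i j → v i = v j := by
    intro i j hij
    rcases mul_eq_zero.1 (h2 i j) with h | h
    · exact absurd h hij.ne'
    · exact sub_eq_zero.1 (mul_self_eq_zero.1 h)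
  obtain ⟨p⟩ := hconn.preconnected i j
  induction p with
  | nil => rfl
  | cons h p ih =>
    rw [← ih]
    rw [SimpleGraph.fromRel_adj] at h
    rcases h.2 with h | h
    · exact hpos _ _ h
    · exact (hpos _ _ h).symm

lemma aux_gap {n : ℕ} (A L : Matrix (Fin n) (Fin n) ℝ) (hA : A.IsSymm)
    (hAnonneg : ∀ i j, 0 ≤ A i j)
    (hconn : (SimpleGraph.fromRel (fun i j => 0 < A i j)).Connected)
    (hL : L = Matrix.diagonal (fun i => ∑ j, A i j) - A)
    (r : ℝ)
    (hr : ∀ μ : ℝ, 0 < μ → ∀ v : Fin n → ℝ, v ≠ 0 → L.mulVec v = μ • v → r ≤ μ)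
    (y : Fin n → ℝ) (hy : ∑ i, y i = 0) :
    r * (y ⬝ᵥ y) ≤ y ⬝ᵥ L.mulVec y := by
  have hS : Lᵀ = L := by
    rw [hL, Matrix.transpose_sub, Matrix.diagonal_transpose, hA.eq]
  have hH : L.IsHermitian := by
    rw [Matrix.IsHermitian, Matrix.conjTranspose_eq_transpose_of_trivial, hS]
  have hin : ∀ a b : EuclideanSpace ℝ (Fin n), inner ℝ a b = a.ofLp ⬝ᵥ b.ofLp := by
    intro a b
    simp [PiLp.inner_apply, dotProduct, mul_comm]
  let b := hH.eigenvectorBasis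
  have hb : ∀ k, L.mulVec (b k).ofLp = hH.eigenvalues k • (b k).ofLp :=
    fun k => hH.mulVec_eigenvectorBasis k
  have key : ∀ u w : Fin n → ℝ, u ⬝ᵥ w = ∑ k, (u ⬝ᵥ (b k).ofLp) * ((b k).ofLp ⬝ᵥ w) := by
    intro u w
    have := b.sum_inner_mul_inner (WithLp.toLp 2 u) (WithLp.toLp 2 w)
    simp only [hin] at this
    exact this.symm
  rw [key y y, key y (L.mulVec y), Finset.mul_sum]
  refine Finset.sum_le_sum fun k _ => ?_
  have hk : (b k).ofLp ⬝ᵥ L.mulVec y = hH.eigenvalues k * ((b k).ofLp ⬝ᵥ y) := by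
    rw [Matrix.dotProduct_mulVec, ← Matrix.mulVec_transpose, hS, hb, smul_dotProduct, smul_eq_mul]
  have hbk : (b k).ofLp ⬝ᵥ (b k).ofLp = 1 := by
    rw [← hin, real_inner_self_eq_norm_sq, b.orthonormal.1 k]; norm_num
  have hnn : 0 ≤ hH.eigenvalues k := by
    have h := aux_bil A L hA hL (b k).ofLp (b k).ofLp
    rw [hb, dotProduct_smul, hbk, smul_eq_mul, mul_one] at h
    rw [h]
    exact mul_nonneg (by norm_num) (Finset.sum_nonneg fun i _ => Finset.sum_nonneg fun j _ =>
      mul_nonneg (hAnonneg i j) (mul_self_nonneg _))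
  rw [hk, dotProduct_comm y]
  rcases hnn.eq_or_lt with h0 | hpos
  · have hc := aux_const A L hA hAnonneg hconn hL (b k).ofLp (by rw [hb, ← h0, zero_smul])
    have hz : (b k).ofLp ⬝ᵥ y = 0 := by
      obtain ⟨i0⟩ := hconn.nonempty
      simp only [dotProduct]
      rw [Finset.sum_congr rfl (fun i _ => by rw [hc i i0]), ← Finset.mul_sum, hy, mul_zero]
    rw [hz]; simp
  · have hne : (b k).ofLp ≠ 0 := by
      intro h; rw [h] at hbk; simp at hbk
    have := hr _ hpos _ hne (hb k)
    nlinarith [mul_self_nonneg ((b k).ofLp ⬝ᵥ y)]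


/-- Under the static triggering condition
`Lᵢᵢ eᵢ² ≤ (σᵢ/2) qᵢ(x)` with `σᵢ ∈ (0,1)`, one has
`−xᵀL(x + e) ≤ −(1 − σ_max) ρ₂(L) · (1/2) xᵀKₙx`. -/
theorem static_trigger_decay_bound
    (n : ℕ) (hn : 2 ≤ n)
    (A : Matrix (Fin n) (Fin n) ℝ)
    (hAsymm : A.IsSymm)
    (hAnonneg : ∀ i j, 0 ≤ A i j)
    (hAdiag : ∀ i, A i i = 0)
    (hconn : (SimpleGraph.fromRel (fun i j => 0 < A i j)).Connected)
    (L : Matrix (Fin n) (Fin n) ℝ)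
    (hL : L = Matrix.diagonal (fun i => ∑ j, A i j) - A)
    (Kn : Matrix (Fin n) (Fin n) ℝ)
    (hKn : Kn = 1 - (n : ℝ)⁻¹ • Matrix.of (fun _ _ => (1 : ℝ)))
    (ρ₂ : ℝ)
    (hρ₂ : IsLeast {μ : ℝ | 0 < μ ∧ ∃ v : Fin n → ℝ, v ≠ 0 ∧ L.mulVec v = μ • v} ρ₂)
    (σ : Fin n → ℝ) (hσ : ∀ i, σ i ∈ Set.Ioo (0 : ℝ) 1)
    (σmax : ℝ) (hσmax : IsGreatest (Set.range σ) σmax)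
    (x e : Fin n → ℝ)
    (q : Fin n → ℝ)
    (hq : ∀ i, q i = -(1/2) * ∑ j, L i j * (x j - x i)^2)
    (htrig : ∀ i, L i i * (e i)^2 ≤ σ i / 2 * q i) :
    -(x ⬝ᵥ L.mulVec (x + e)) ≤ -(1 - σmax) * ρ₂ * ((1/2) * (x ⬝ᵥ Kn.mulVec x)) := by
  have hrpos : 0 < ρ₂ := hρ₂.1.1
  have hn0 : (n : ℝ) ≠ 0 := by positivity
  have hLii : ∀ i, L i i = ∑ j, A i j := by
    intro i; rw [hL]; simp [hAdiag]
  have hqA : ∀ i, q i = (1/2) * ∑ j, A i j * (x j - x i)^2 := by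
    intro i
    rw [hq i, Finset.mul_sum, Finset.mul_sum]
    refine Finset.sum_congr rfl fun j _ => ?_
    by_cases hij : i = j
    · subst hij; simp
    · rw [hL]; simp [Matrix.diagonal_apply_ne _ hij]
  have hqnn : ∀ i, 0 ≤ q i := by
    intro i; rw [hqA i]
    exact mul_nonneg (by norm_num) (Finset.sum_nonneg fun j _ =>
      mul_nonneg (hAnonneg i j) (sq_nonneg _))
  have hxx : x ⬝ᵥ L.mulVec x = ∑ i, q i := by
    rw [aux_bil A L hAsymm hL, Finset.mul_sum]
    refine Finset.sum_congr rfl fun i _ => ?_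
    rw [hqA i]
    congr 1
    refine Finset.sum_congr rfl fun j _ => ?_
    ring
  have hxe : -(x ⬝ᵥ L.mulVec e) ≤ ∑ i, (L i i * (e i)^2 + (1/2) * q i) := by
    have h1 : x ⬝ᵥ L.mulVec e = e ⬝ᵥ L.mulVec x := by
      rw [aux_bil A L hAsymm hL, aux_bil A L hAsymm hL]
      simp only [mul_comm (x _ - x _)]
    rw [h1]
    simp only [dotProduct, aux_mulVec A L hL, ← Finset.sum_neg_distrib]
    refine Finset.sum_le_sum fun i _ => ?_
    rw [hLii i, hqA i, Finset.sum_mul, Finset.mul_sum, ← Finset.sum_neg_distrib,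
      Finset.mul_sum, Finset.mul_sum, ← Finset.sum_add_distrib]
    refine Finset.sum_le_sum fun j _ => ?_
    have := mul_nonneg (hAnonneg i j) (sq_nonneg (e i + (x i - x j)/2))
    nlinarith
  have hsum : ∑ i, (L i i * (e i)^2 + (1/2) * q i) ≤ (σmax / 2 + 1/2) * ∑ i, q i := by
    rw [Finset.mul_sum]
    refine Finset.sum_le_sum fun i _ => ?_
    have h1 := htrig i
    have h2 : σ i ≤ σmax := hσmax.2 ⟨i, rfl⟩
    nlinarith [mul_le_mul_of_nonneg_right h2 (hqnn i)]
  have hσ1 : σmax < 1 := by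
    obtain ⟨i, hi⟩ := hσmax.1
    rw [← hi]; exact (hσ i).2
  -- spectral gap
  have hgap : ρ₂ * (x ⬝ᵥ Kn.mulVec x) ≤ x ⬝ᵥ L.mulVec x := by
    set m : ℝ := (n : ℝ)⁻¹ * ∑ i, x i with hm
    have hmn : (n : ℝ) * m = ∑ i, x i := by rw [hm]; field_simp
    have hg := aux_gap A L hAsymm hAnonneg hconn hL ρ₂
      (fun μ hμ v hv hLv => hρ₂.2 ⟨hμ, v, hv, hLv⟩) (fun i => x i - m)
      (by rw [Finset.sum_sub_distrib]; simp [hmn])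
    have e1 : (fun i => x i - m) ⬝ᵥ L.mulVec (fun i => x i - m) = x ⬝ᵥ L.mulVec x := by
      rw [aux_bil A L hAsymm hL, aux_bil A L hAsymm hL]
      simp only [sub_sub_sub_cancel_right]
    have e2 : x ⬝ᵥ Kn.mulVec x = (fun i => x i - m) ⬝ᵥ (fun i => x i - m) := by
      have hK : Kn.mulVec x = fun i => x i - m := by
        rw [hKn, Matrix.sub_mulVec, Matrix.one_mulVec, Matrix.smul_mulVec]
        funext i
        simp [Matrix.mulVec, dotProduct, hm]
      rw [hK]
      have hz : ∑ i, m * (x i - m) = 0 := by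
        rw [← Finset.mul_sum, Finset.sum_sub_distrib]; simp [hmn]
      simp only [dotProduct, sub_mul (x _) m, Finset.sum_sub_distrib, hz, sub_zero]
    rw [e2, ← e1]; exact hg
  rw [Matrix.mulVec_add, dotProduct_add]
  have := mul_le_mul_of_nonneg_left hgap (by linarith : 0 ≤ (1 - σmax) / 2)
  rw [hxx] at this ⊢
  nlinarith
end

section
/- Consider a connected weighted undirected graph on n ≥ 2 vertices with Laplacian L, constants σ₁,…,σₙ ∈ (0,1), σ_max = maxᵢ σᵢ. Let x : [0,∞) → ℝⁿ be differentiable and e : [0,∞) → ℝⁿ be such that ẋ(t) = −L(x(t) + e(t)) for all t ≥ 0, and suppose the static triggering condition Lᵢᵢ eᵢ(t)² ≤ (σᵢ/2) qᵢ(x(t)) holds for every i and every t ≥ 0, where qᵢ(x) = −(1/2) Σⱼ Lᵢⱼ (xⱼ − xᵢ)². Then, with V(t) = (1/2) Σᵢ₌₁ⁿ (xᵢ(t) − x̄(0))² and x̄(0) = (1/n) Σᵢ xᵢ(0), one has V(t) ≤ V(0) e^{−(1 − σ_max) ρ₂(L) t} for all t ≥ 0; in particular each xᵢ(t) converges exponentially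 to the initial average x̄(0). -/
open Matrix BigOperators

lemma quad_aux {n : ℕ} (A : Matrix (Fin n) (Fin n) ℝ) (hA : A.IsSymm)
    (L : Matrix (Fin n) (Fin n) ℝ)
    (hL : L = Matrix.diagonal (fun i => ∑ j, A i j) - A) (v : Fin n → ℝ) (i : Fin n) :
    (L *ᵥ v) i = ∑ j, A i j * (v i - v j) := by
  subst hL
  rw [Matrix.sub_mulVec, Pi.sub_apply, Matrix.mulVec_diagonal]
  simp only [Matrix.mulVec, dotProduct, mul_sub, Finset.sum_sub_distrib, Finset.sum_mul]

lemma sum_aux {n : ℕ} (A : Matrix (Fin n) (Fin n) ℝ) (hA : A.IsSymm)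
    (L : Matrix (Fin n) (Fin n) ℝ)
    (hL : L = Matrix.diagonal (fun i => ∑ j, A i j) - A) (v w : Fin n → ℝ) :
    ∑ i, w i * (L *ᵥ v) i = (1/2) * ∑ i, ∑ j, A i j * ((w i - w j) * (v i - v j)) := by
  have h1 : ∑ i, w i * (L *ᵥ v) i = ∑ i, ∑ j, w i * (A i j * (v i - v j)) := by
    simp only [quad_aux A hA L hL, Finset.mul_sum]
  have h2 : ∑ i, w i * (L *ᵥ v) i = ∑ i, ∑ j, w j * (A i j * (v j - v i)) := by
    rw [h1, Finset.sum_comm]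
    refine Finset.sum_congr rfl fun i _ => Finset.sum_congr rfl fun j _ => ?_
    rw [hA.apply i j]
  have h3 : ∑ i, ∑ j, A i j * ((w i - w j) * (v i - v j))
      = ∑ i, ∑ j, w i * (A i j * (v i - v j)) + ∑ i, ∑ j, w j * (A i j * (v j - v i)) := by
    simp only [← Finset.sum_add_distrib]
    refine Finset.sum_congr rfl fun i _ => Finset.sum_congr rfl fun j _ => ?_
    ring
  rw [h3, ← h1, ← h2]; ring

lemma gap_aux {n : ℕ}
    (A : Matrix (Fin n) (Fin n) ℝ)
    (hAsymm : A.IsSymm)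
    (hAnonneg : ∀ i j, 0 ≤ A i j)
    (hconn : (SimpleGraph.fromRel (fun i j => 0 < A i j)).Connected)
    (L : Matrix (Fin n) (Fin n) ℝ)
    (hL : L = Matrix.diagonal (fun i => ∑ j, A i j) - A)
    (ρ₂ : ℝ)
    (hρ₂ : IsLeast {μ : ℝ | 0 < μ ∧ ∃ v : Fin n → ℝ, v ≠ 0 ∧ L.mulVec v = μ • v} ρ₂)
    (z : Fin n → ℝ) (hz : ∑ i, z i = 0) :
    ρ₂ * ∑ i, z i ^ 2 ≤ ∑ i, z i * (L *ᵥ z) i := by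
  have hH : L.IsHermitian := by
    subst hL
    rw [Matrix.IsHermitian, Matrix.conjTranspose_eq_transpose_of_trivial, Matrix.transpose_sub,
      Matrix.diagonal_transpose, hAsymm.eq]
  set b := hH.eigenvectorBasis with hb
  have hin : ∀ u w : Fin n → ℝ, inner ℝ (WithLp.toLp 2 u) (WithLp.toLp 2 w) = ∑ i, u i * w i := by
    intro u w
    simp [PiLp.inner_apply, mul_comm]
  have hbb : ∀ i, b i = WithLp.toLp 2 (fun k => b i k) := fun i => rfl
  have hev : ∀ i, L *ᵥ (fun k => b i k) = hH.eigenvalues i • (fun k => b i k) := by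
    intro i
    exact hH.mulVec_eigenvectorBasis i
  have hsq : ∑ i, z i ^ 2 = ∑ i, (∑ k, b i k * z k) ^ 2 := by
    have := b.sum_inner_mul_inner (WithLp.toLp 2 z) (WithLp.toLp 2 z)
    rw [hin] at this
    simp only [pow_two]
    rw [← this]
    refine Finset.sum_congr rfl fun i _ => ?_
    rw [hbb i, hin, hin]
    simp only [mul_comm]
  have hsymm : ∀ u w : Fin n → ℝ, ∑ i, u i * (L *ᵥ w) i = ∑ i, w i * (L *ᵥ u) i := by
    intro u w
    rw [sum_aux A hAsymm L hL, sum_aux A hAsymm L hL]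
    simp only [mul_comm]
  have hq : ∑ i, z i * (L *ᵥ z) i = ∑ i, hH.eigenvalues i * (∑ k, b i k * z k) ^ 2 := by
    have := b.sum_inner_mul_inner (WithLp.toLp 2 z) (WithLp.toLp 2 (L *ᵥ z))
    rw [hin] at this
    rw [← this]
    refine Finset.sum_congr rfl fun i _ => ?_
    rw [hbb i, hin, hin, hsymm (fun k => b i k) z, hev i]
    simp only [Pi.smul_apply, smul_eq_mul]
    have e1 : ∑ k, z k * (hH.eigenvalues i * b i k) = hH.eigenvalues i * ∑ k, b i k * z k := by
      rw [Finset.mul_sum]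
      exact Finset.sum_congr rfl fun k _ => by ring
    have e2 : ∑ k, z k * b i k = ∑ k, b i k * z k :=
      Finset.sum_congr rfl fun k _ => by ring
    rw [e1, e2]; ring
  rw [hsq, hq, Finset.mul_sum]
  refine Finset.sum_le_sum fun i _ => ?_
  have hne : (fun k => b i k) ≠ 0 := by
    intro h
    have h1 := b.orthonormal.ne_zero i
    apply h1
    rw [hbb i, h]; rfl
  have hqi := sum_aux A hAsymm L hL (fun k => b i k) (fun k => b i k)
  rw [hev i] at hqi
  have hterm : ∀ k l, 0 ≤ A k l * ((b i k - b i l) * (b i k - b i l)) := fun k l =>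
    mul_nonneg (hAnonneg k l) (mul_self_nonneg _)
  have hnorm : 0 < ∑ k, b i k * b i k := by
    obtain ⟨k, hk⟩ := Function.ne_iff.mp hne
    exact Finset.sum_pos' (fun _ _ => mul_self_nonneg _) ⟨k, Finset.mem_univ _, mul_self_pos.mpr hk⟩
  have hqi' : hH.eigenvalues i * ∑ k, b i k * b i k
      = (1/2) * ∑ k, ∑ l, A k l * ((b i k - b i l) * (b i k - b i l)) := by
    rw [← hqi, Finset.mul_sum]
    exact Finset.sum_congr rfl fun k _ => by simp only [Pi.smul_apply, smul_eq_mul]; ring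
  have hdn : 0 ≤ ∑ k, ∑ l, A k l * ((b i k - b i l) * (b i k - b i l)) :=
    Finset.sum_nonneg fun k _ => Finset.sum_nonneg fun l _ => hterm k l
  have hnn : 0 ≤ hH.eigenvalues i := by
    by_contra hc
    push Not at hc
    nlinarith [mul_neg_of_neg_of_pos hc hnorm]
  rcases hnn.lt_or_eq with hpos | h0
  · exact mul_le_mul_of_nonneg_right (hρ₂.2 ⟨hpos, _, hne, hev i⟩) (sq_nonneg _)
  · rw [← h0, zero_mul] at hqi'
    have hs : ∑ k, ∑ l, A k l * ((b i k - b i l) * (b i k - b i l)) = 0 := by linarith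
    have hz0 : ∀ k l, A k l * ((b i k - b i l) * (b i k - b i l)) = 0 := by
      intro k l
      have := (Finset.sum_eq_zero_iff_of_nonneg
        (fun k _ => Finset.sum_nonneg fun l _ => hterm k l)).mp hs k (Finset.mem_univ _)
      exact (Finset.sum_eq_zero_iff_of_nonneg (fun l _ => hterm k l)).mp this l (Finset.mem_univ _)
    have hz1 : ∀ k l, 0 < A k l → b i k = b i l := by
      intro k l h
      rcases mul_eq_zero.mp (hz0 k l) with h' | h'
      · exact absurd h' h.ne'
      · exact sub_eq_zero.mp (mul_self_eq_zero.mp h')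
    have hconst : ∀ k l, b i k = b i l := by
      intro k l
      obtain ⟨p⟩ := hconn.preconnected k l
      induction p with
      | nil => rfl
      | cons h _ ih =>
        rw [← ih]
        rw [SimpleGraph.fromRel_adj] at h
        rcases h.2 with h | h
        · exact hz1 _ _ h
        · exact (hz1 _ _ h).symm
    have : ∑ k, b i k * z k = 0 := by
      rcases isEmpty_or_nonempty (Fin n) with hh | ⟨⟨k0⟩⟩
      · simp
      · rw [Finset.sum_congr rfl (fun k _ => by rw [hconst k k0]), ← Finset.mul_sum, hz, mul_zero]
    rw [this]; simp


/-- Under the static triggering law (9), the Lyapunov function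
`V(t) = (1/2) Σᵢ (xᵢ(t) − x̄(0))²` satisfies
`V(t) ≤ V(0) e^{−(1 − σ_max) ρ₂(L) t}`, i.e. consensus is reached exponentially. -/
theorem static_trigger_exponential_consensus
    (n : ℕ) (hn : 2 ≤ n)
    (A : Matrix (Fin n) (Fin n) ℝ)
    (hAsymm : A.IsSymm)
    (hAnonneg : ∀ i j, 0 ≤ A i j)
    (hAdiag : ∀ i, A i i = 0)
    (hconn : (SimpleGraph.fromRel (fun i j => 0 < A i j)).Connected)
    (L : Matrix (Fin n) (Fin n) ℝ)
    (hL : L = Matrix.diagonal (fun i => ∑ j, A i j) - A)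
    (ρ₂ : ℝ)
    (hρ₂ : IsLeast {μ : ℝ | 0 < μ ∧ ∃ v : Fin n → ℝ, v ≠ 0 ∧ L.mulVec v = μ • v} ρ₂)
    (σ : Fin n → ℝ) (hσ : ∀ i, σ i ∈ Set.Ioo (0 : ℝ) 1)
    (σmax : ℝ) (hσmax : IsGreatest (Set.range σ) σmax)
    (x e : ℝ → Fin n → ℝ)
    (hx : ∀ t : ℝ, 0 ≤ t → HasDerivAt x (-(L.mulVec (x t + e t))) t)
    (q : ℝ → Fin n → ℝ)
    (hq : ∀ t i, q t i = -(1/2) * ∑ j, L i j * (x t j - x t i)^2)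
    (htrig : ∀ t : ℝ, 0 ≤ t → ∀ i, L i i * (e t i)^2 ≤ σ i / 2 * q t i)
    (xbar : ℝ) (hxbar : xbar = (1 / (n : ℝ)) * ∑ i, x 0 i)
    (V : ℝ → ℝ)
    (hV : ∀ t, V t = (1/2) * ∑ i, (x t i - xbar)^2) :
    ∀ t : ℝ, 0 ≤ t → V t ≤ V 0 * Real.exp (-(1 - σmax) * ρ₂ * t) := by

  have hsymmA : ∀ i j, A i j = A j i := fun i j => hAsymm.apply j i
  have hn0 : (n : ℝ) ≠ 0 := by positivity
  have hxi : ∀ t : ℝ, 0 ≤ t → ∀ i, HasDerivAt (fun s => x s i) (-(L *ᵥ (x t + e t)) i) t :=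
    fun t ht i => (hasDerivAt_pi.mp (hx t ht)) i
  have hLsum : ∀ w : Fin n → ℝ, ∑ i, (L *ᵥ w) i = 0 := by
    intro w
    have := sum_aux A hAsymm L hL w (fun _ => 1)
    simpa using this
  -- the average is preserved
  have hcons : ∀ t : ℝ, 0 ≤ t → ∑ i, x t i = ∑ i, x 0 i := by
    intro t ht
    have hd : ∀ s : ℝ, 0 ≤ s → HasDerivAt (fun s => ∑ i, x s i) 0 s := by
      intro s hs
      have := HasDerivAt.fun_sum (u := Finset.univ) (fun i _ => hxi s hs i)
      rwa [Finset.sum_neg_distrib, hLsum, neg_zero] at this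
    exact constant_of_has_deriv_right_zero
      (fun s hs => (hd s hs.1).continuousAt.continuousWithinAt)
      (fun s hs => (hd s hs.1).hasDerivWithinAt) t ⟨ht, le_rfl⟩
  have hz : ∀ t : ℝ, 0 ≤ t → ∑ i, (x t i - xbar) = 0 := by
    intro t ht
    rw [Finset.sum_sub_distrib, hcons t ht, hxbar]
    simp only [Finset.sum_const, Finset.card_univ, Fintype.card_fin, nsmul_eq_mul]
    field_simp
    ring
  have hLd : ∀ i, L i i = ∑ j, A i j := by
    intro i; subst hL; simp [hAdiag]
  have hqA : ∀ t i, q t i = (1/2) * ∑ j, A i j * (x t i - x t j)^2 := by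
    intro t i
    rw [hq, neg_mul, ← mul_neg, ← Finset.sum_neg_distrib]
    congr 1
    refine Finset.sum_congr rfl fun j _ => ?_
    by_cases h : i = j
    · subst h; simp
    · subst hL
      rw [Matrix.sub_apply, Matrix.diagonal_apply_ne _ h]; ring
  have hσm1 : σmax < 1 := by
    obtain ⟨i, rfl⟩ := hσmax.1
    exact (hσ i).2
  have hVd : ∀ t : ℝ, 0 ≤ t →
      HasDerivAt V (∑ i, (x t i - xbar) * (-(L *ᵥ (x t + e t)) i)) t := by
    intro t ht
    have h1 : HasDerivAt (fun s => (1/2) * ∑ i, (x s i - xbar)^2)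
        ((1/2) * ∑ i, (2 * (x t i - xbar) * (-(L *ᵥ (x t + e t)) i))) t := by
      refine HasDerivAt.const_mul _ (HasDerivAt.fun_sum fun i _ => ?_)
      have := ((hxi t ht i).sub_const xbar).fun_pow 2
      simpa using this
    rw [show V = fun s => (1/2) * ∑ i, (x s i - xbar)^2 from funext hV]
    convert h1 using 1
    rw [Finset.mul_sum]
    exact Finset.sum_congr rfl fun i _ => by ring
  have hineq : ∀ t : ℝ, 0 ≤ t →
      ∑ i, (x t i - xbar) * (-(L *ᵥ (x t + e t)) i) ≤ -((1 - σmax) * ρ₂) * V t := by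
    intro t ht
    have hgap := gap_aux A hAsymm hAnonneg hconn L hL ρ₂ hρ₂ (fun i => x t i - xbar) (hz t ht)
    have hQ1 := sum_aux A hAsymm L hL (fun i => x t i - xbar) (fun i => x t i - xbar)
    simp only [sub_sub_sub_cancel_right] at hQ1
    have hQ : ∑ i, q t i = (1/2) * ∑ i, ∑ j, A i j * ((x t i - x t j) * (x t i - x t j)) := by
      simp only [hqA, ← Finset.mul_sum, pow_two]
    have hsplit : ∑ i, (x t i - xbar) * (-(L *ᵥ (x t + e t)) i)
        = - ∑ i, q t i - ∑ i, e t i * (L *ᵥ x t) i := by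
      have h1 := sum_aux A hAsymm L hL (x t + e t) (fun i => x t i - xbar)
      have h2 := sum_aux A hAsymm L hL (x t) (e t)
      simp only [mul_neg, Finset.sum_neg_distrib]
      rw [h1, h2, hQ]
      rw [← neg_add', ← mul_add]
      simp only [← Finset.sum_add_distrib]
      congr 2
      refine Finset.sum_congr rfl fun i _ => Finset.sum_congr rfl fun j _ => ?_
      simp only [Pi.add_apply]; ring
    have hqn : ∀ i, 0 ≤ q t i := fun i => by
      rw [hqA]
      exact mul_nonneg (by norm_num)
        (Finset.sum_nonneg fun j _ => mul_nonneg (hAnonneg i j) (sq_nonneg _))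
    have hei : ∀ i, -(e t i * (L *ᵥ x t) i) ≤ (σmax + 1) / 2 * q t i := by
      intro i
      have h1 : -(e t i * (L *ᵥ x t) i) ≤ L i i * (e t i)^2 + q t i / 2 := by
        rw [quad_aux A hAsymm L hL, hLd, hqA, Finset.mul_sum, ← Finset.sum_neg_distrib,
          Finset.sum_mul, Finset.mul_sum, Finset.sum_div, ← Finset.sum_add_distrib]
        refine Finset.sum_le_sum fun j _ => ?_
        nlinarith [mul_nonneg (hAnonneg i j) (sq_nonneg (e t i + (x t i - x t j) / 2))]
      have h2 := htrig t ht i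
      have h3 : σ i * q t i ≤ σmax * q t i :=
        mul_le_mul_of_nonneg_right (hσmax.2 ⟨i, rfl⟩) (hqn i)
      linarith
    have hes : - ∑ i, e t i * (L *ᵥ x t) i ≤ (σmax + 1) / 2 * ∑ i, q t i := by
      rw [← Finset.sum_neg_distrib, Finset.mul_sum]
      exact Finset.sum_le_sum fun i _ => hei i
    have hfin : ρ₂ * (2 * V t) ≤ ∑ i, q t i := by
      rw [hQ, ← hQ1, hV]
      calc _ = _ := by ring
        _ ≤ _ := hgap
    rw [hsplit]
    nlinarith [mul_le_mul_of_nonneg_left hfin (sub_nonneg.mpr hσm1.le)]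
  intro t ht
  set c := (1 - σmax) * ρ₂ with hc
  have hWd : ∀ s : ℝ, 0 ≤ s → HasDerivAt (fun s => V s * Real.exp (c * s))
      ((∑ i, (x s i - xbar) * (-(L *ᵥ (x s + e s)) i)) * Real.exp (c * s)
        + V s * (Real.exp (c * s) * c)) s := by
    intro s hs
    refine (hVd s hs).mul ?_
    have := ((hasDerivAt_id s).const_mul c).exp
    simpa using this
  have hanti : AntitoneOn (fun s => V s * Real.exp (c * s)) (Set.Ici 0) := by
    refine antitoneOn_of_deriv_nonpos (convex_Ici 0)
      (fun s hs => (hWd s hs).continuousAt.continuousWithinAt)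
      (fun s hs => ?_) (fun s hs => ?_)
    · rw [interior_Ici] at hs
      exact (hWd s (le_of_lt hs)).differentiableAt.differentiableWithinAt
    · rw [interior_Ici] at hs
      rw [(hWd s (le_of_lt hs)).deriv]
      have := mul_le_mul_of_nonneg_right (hineq s (le_of_lt hs)) (Real.exp_pos (c * s)).le
      linarith
  have h := hanti (Set.mem_Ici.mpr le_rfl) (Set.mem_Ici.mpr ht) ht
  simp only [mul_zero, Real.exp_zero, mul_one] at h
  have he : -(1 - σmax) * ρ₂ * t = -(c * t) := by rw [hc]; ring
  rw [he, Real.exp_neg, ← div_eq_mul_inv, le_div_iff₀ (Real.exp_pos _)]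
  exact h
end

section
/- Let β > 0, ξ ∈ [0,1], θ > 0 be constants and let s : [0,∞) → ℝ be continuous. Suppose η : [0,∞) → ℝ is differentiable with η(0) > 0, satisfies η̇(t) = −β η(t) + ξ s(t) for all t ≥ 0, and satisfies the triggering inequality −θ s(t) ≤ η(t) for all t ≥ 0. Then η(t) ≥ η(0) e^{−(β + ξ/θ) t} > 0 for all t ≥ 0. -/
/-- The internal dynamic variable `η` with
`η̇(t) = −β η(t) + ξ s(t)`, `η(0) > 0`, and triggering inequality
`−θ s(t) ≤ η(t)` stays positive: `η(t) ≥ η(0) e^{−(β + ξ/θ) t} > 0`. -/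
theorem dynamic_variable_positive_lower_bound
    (β ξ θ : ℝ) (hβ : 0 < β) (hξ : ξ ∈ Set.Icc (0 : ℝ) 1) (hθ : 0 < θ)
    (s η : ℝ → ℝ)
    (hs : ContinuousOn s (Set.Ici (0 : ℝ)))
    (hη0 : 0 < η 0)
    (hη : ∀ t : ℝ, 0 ≤ t → HasDerivAt η (-β * η t + ξ * s t) t)
    (htrig : ∀ t : ℝ, 0 ≤ t → -θ * s t ≤ η t) :
    ∀ t : ℝ, 0 ≤ t → η 0 * Real.exp (-(β + ξ / θ) * t) ≤ η t ∧ 0 < η t := by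
  intro t ht
  have hd : ∀ x : ℝ, 0 ≤ x → HasDerivAt (fun x => η x * Real.exp ((β + ξ / θ) * x))
      ((-β * η x + ξ * s x) * Real.exp ((β + ξ / θ) * x)
        + η x * (Real.exp ((β + ξ / θ) * x) * ((β + ξ / θ) * 1))) x := by
    intro x hx
    exact (hη x hx).mul (((hasDerivAt_id x).const_mul (β + ξ / θ)).exp)
  have hmono : MonotoneOn (fun x => η x * Real.exp ((β + ξ / θ) * x)) (Set.Ici 0) := by
    apply monotoneOn_of_deriv_nonneg (convex_Ici 0)
    · intro x hx
      exact (hd x hx).continuousAt.continuousWithinAt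
    · intro x hx
      rw [interior_Ici] at hx
      exact (hd x (le_of_lt hx)).differentiableAt.differentiableWithinAt
    · intro x hx
      rw [interior_Ici] at hx
      have hx0 : 0 ≤ x := le_of_lt hx
      rw [(hd x hx0).deriv]
      have e : (-β * η x + ξ * s x) * Real.exp ((β + ξ / θ) * x)
        + η x * (Real.exp ((β + ξ / θ) * x) * ((β + ξ / θ) * 1))
        = (ξ / θ) * (η x - -θ * s x) * Real.exp ((β + ξ / θ) * x) := by
        field_simp
        ring
      rw [e]
      exact mul_nonneg (mul_nonneg (div_nonneg hξ.1 hθ.le) (sub_nonneg.2 (htrig x hx0)))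
        (Real.exp_pos _).le
  have h := hmono (Set.mem_Ici.2 le_rfl) (Set.mem_Ici.2 ht) ht
  simp only [mul_zero, Real.exp_zero, mul_one] at h
  have h2 : η 0 * Real.exp (-(β + ξ / θ) * t) ≤ η t := by
    rw [neg_mul, Real.exp_neg, ← div_eq_mul_inv, div_le_iff₀ (Real.exp_pos _)]
    exact h
  exact ⟨h2, lt_of_lt_of_le (mul_pos hη0 (Real.exp_pos _)) h2⟩
end

section
/- (Consensus part of Theorem 1.) Consider a connected weighted undirected graph on n ≥ 2 vertices with Laplacian L. Let βᵢ > 0, ξᵢ ∈ [0,1], σᵢ ∈ [0,1) with σ_max = maxᵢ σᵢ, and θᵢ > 0 with θᵢ > (1 − ξᵢ)/βᵢ for every i. Let x : [0,∞) → ℝⁿ and η : [0,∞) → ℝⁿ be differentiable and e : [0,∞) → ℝⁿ be such that for all t ≥ 0 and all i: ẋ(t) = −L(x(t) + e(t)); η̇ᵢ(t) = −βᵢηᵢ(t) + ξᵢ((σᵢ/2)qᵢ(x(t)) − Lᵢᵢeᵢ(t)²); ηᵢ(0) > 0; and the dynamic triggering condition θᵢ(Lᵢᵢeᵢ(t)²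 − (σᵢ/2)qᵢ(x(t))) ≤ ηᵢ(t) holds, where qᵢ(x) = −(1/2) Σⱼ Lᵢⱼ (xⱼ − xᵢ)². Then, with V(t) = (1/2) Σᵢ (xᵢ(t) − x̄(0))², W(t) = V(t) + Σᵢ ηᵢ(t), k_d = minᵢ (βᵢ − (1 − ξᵢ)/θᵢ) > 0, and k_W = min{(1 − σ_max) ρ₂(L), k_d} > 0, one has V(t) < W(t) ≤ W(0) e^{−k_W t} for all t ≥ 0; in particular each xᵢ(t) converges exponentially to the initial average x̄(0) = (1/n) Σᵢ xᵢ(0). -/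
open Matrix BigOperators

lemma lap_mulVec {n : ℕ} (A : Matrix (Fin n) (Fin n) ℝ) (v : Fin n → ℝ) (i : Fin n) :
    ((Matrix.diagonal (fun i => ∑ j, A i j) - A).mulVec v) i = ∑ j, A i j * (v i - v j) := by
  rw [Matrix.sub_mulVec, Pi.sub_apply, Matrix.mulVec_diagonal]
  simp only [Matrix.mulVec, dotProduct, mul_sub, Finset.sum_sub_distrib, Finset.sum_mul]

lemma lap_form {n : ℕ} (A : Matrix (Fin n) (Fin n) ℝ) (hA : A.IsSymm) (u v : Fin n → ℝ) :
    ∑ i, u i * ((Matrix.diagonal (fun i => ∑ j, A i j) - A).mulVec v) i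
      = (1/2) * ∑ i, ∑ j, A i j * ((u i - u j) * (v i - v j)) := by
  have h1 : ∑ i, u i * ((Matrix.diagonal (fun i => ∑ j, A i j) - A).mulVec v) i
      = ∑ i, ∑ j, A i j * (u i * (v i - v j)) := by
    refine Finset.sum_congr rfl fun i _ => ?_
    rw [lap_mulVec, Finset.mul_sum]
    exact Finset.sum_congr rfl fun j _ => by ring
  have h2 : ∑ i, ∑ j, A i j * (u i * (v i - v j)) = ∑ i, ∑ j, A i j * (u j * (v j - v i)) := by
    rw [Finset.sum_comm]
    refine Finset.sum_congr rfl fun i _ => Finset.sum_congr rfl fun j _ => ?_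
    rw [hA.apply]
  have h3 : ∑ i, ∑ j, A i j * ((u i - u j) * (v i - v j))
      = ∑ i, ∑ j, A i j * (u i * (v i - v j)) + ∑ i, ∑ j, A i j * (u j * (v j - v i)) := by
    simp only [← Finset.sum_add_distrib]
    exact Finset.sum_congr rfl fun i _ => Finset.sum_congr rfl fun j _ => by ring
  rw [h1, h3, ← h2]; ring

lemma lap_null {n : ℕ} (A : Matrix (Fin n) (Fin n) ℝ) (hA : A.IsSymm)
    (hAnonneg : ∀ i j, 0 ≤ A i j)
    (hconn : (SimpleGraph.fromRel (fun i j => 0 < A i j)).Connected) (v : Fin n → ℝ)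
    (hv : ∑ i, v i * ((Matrix.diagonal (fun i => ∑ j, A i j) - A).mulVec v) i = 0) :
    ∀ i j, v i = v j := by
  rw [lap_form A hA] at hv
  have hnn : ∀ i j, 0 ≤ A i j * ((v i - v j) * (v i - v j)) := fun i j =>
    mul_nonneg (hAnonneg i j) (mul_self_nonneg _)
  have h0 : ∑ i, ∑ j, A i j * ((v i - v j) * (v i - v j)) = 0 := by linarith
  have h1 : ∀ i j, A i j * ((v i - v j) * (v i - v j)) = 0 := by
    intro i j
    have := (Finset.sum_eq_zero_iff_of_nonneg
      (fun i _ => Finset.sum_nonneg fun j _ => hnn i j)).1 h0 i (Finset.mem_univ _)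
    exact (Finset.sum_eq_zero_iff_of_nonneg (fun j _ => hnn i j)).1 this j (Finset.mem_univ _)
  have h2 : ∀ i j, 0 < A i j → v i = v j := by
    intro i j hij
    have := h1 i j
    rcases mul_eq_zero.1 this with h | h
    · exact absurd h hij.ne'
    · exact sub_eq_zero.1 (mul_self_eq_zero.1 h)
  intro i j
  obtain ⟨w⟩ := hconn.preconnected i j
  induction w with
  | nil => rfl
  | cons hadj _ ih =>
    rw [← ih]
    rw [SimpleGraph.fromRel_adj] at hadj
    rcases hadj.2 with h | h
    · exact h2 _ _ h
    · exact (h2 _ _ h).symm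

lemma lap_gap {n : ℕ} (A : Matrix (Fin n) (Fin n) ℝ) (hA : A.IsSymm)
    (hAnonneg : ∀ i j, 0 ≤ A i j)
    (hconn : (SimpleGraph.fromRel (fun i j => 0 < A i j)).Connected)
    (L : Matrix (Fin n) (Fin n) ℝ)
    (hL : L = Matrix.diagonal (fun i => ∑ j, A i j) - A)
    (ρ : ℝ)
    (hρ : ∀ μ : ℝ, 0 < μ → (∃ v : Fin n → ℝ, v ≠ 0 ∧ L.mulVec v = μ • v) → ρ ≤ μ)
    (y : Fin n → ℝ) (hy : ∑ i, y i = 0) :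
    ρ * ∑ i, y i ^ 2 ≤ ∑ i, y i * (L.mulVec y) i := by
  have hLs : L.IsHermitian := by
    rw [hL]
    have h1 : A.IsHermitian := by
      rw [Matrix.IsHermitian, Matrix.conjTranspose_eq_transpose_of_trivial]; exact hA
    exact (Matrix.isHermitian_diagonal _).sub h1
  let b := hLs.eigenvectorBasis
  let lam := hLs.eigenvalues
  have hb : ∀ k, L.mulVec (b k) = lam k • (b k : Fin n → ℝ) := fun k =>
    hLs.mulVec_eigenvectorBasis k
  have hsymm : ∀ u v : Fin n → ℝ, ∑ i, u i * (L.mulVec v) i = ∑ i, v i * (L.mulVec u) i := by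
    intro u v
    rw [hL, lap_form A hA, lap_form A hA]
    congr 1
    exact Finset.sum_congr rfl fun i _ => Finset.sum_congr rfl fun j _ => by ring
  have hinner : ∀ u v : Fin n → ℝ, inner ℝ (WithLp.toLp 2 u) (WithLp.toLp 2 v) = ∑ i, u i * v i := by
    intro u v
    simp [PiLp.inner_apply, mul_comm]
  let c : Fin n → ℝ := fun k => ∑ i, y i * b k i
  have hP : ∀ u v : Fin n → ℝ, ∑ i, u i * v i = ∑ k, (∑ i, u i * b k i) * (∑ i, v i * b k i) := by
    intro u v
    rw [← hinner, ← b.sum_inner_mul_inner]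
    refine Finset.sum_congr rfl fun k _ => ?_
    have e1 : b k = WithLp.toLp 2 (b k : Fin n → ℝ) := rfl
    rw [real_inner_comm (WithLp.toLp 2 v) (b k)] 
    rw [e1, hinner, hinner]
  have h1 : ∑ i, y i ^ 2 = ∑ k, c k * c k := by
    rw [← hP]; exact Finset.sum_congr rfl fun i _ => by ring
  have h2 : ∑ i, y i * (L.mulVec y) i = ∑ k, lam k * (c k * c k) := by
    rw [hP]
    refine Finset.sum_congr rfl fun k _ => ?_
    have : ∑ i, (L.mulVec y) i * b k i = lam k * c k := by
      have := hsymm (b k) y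
      rw [hb k] at this
      simp only [c, Finset.mul_sum]
      calc _ = ∑ i, (b k) i * (L.mulVec y) i := Finset.sum_congr rfl fun i _ => by ring
        _ = _ := this
        _ = _ := Finset.sum_congr rfl fun i _ => by simp; ring
    rw [this]; simp only [c]; ring
  rw [h1, h2, Finset.mul_sum]
  refine Finset.sum_le_sum fun k _ => ?_
  have hbne : (b k : Fin n → ℝ) ≠ 0 := by
    intro h
    have : b k = 0 := by ext i; exact congrFun h i
    exact b.orthonormal.ne_zero k this
  have hone : ∑ i, (b k) i * (b k) i = 1 := by
    have := b.orthonormal.1 k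
    have h3 : inner ℝ (b k) (b k) = (1:ℝ) := by rw [real_inner_self_eq_norm_sq, this]; norm_num
    rw [← h3]; exact (hinner _ _).symm
  have hlam : lam k = ∑ i, (b k) i * (L.mulVec (b k)) i := by
    rw [hb k]
    calc lam k = lam k * ∑ i, (b k) i * (b k) i := by rw [hone, mul_one]
      _ = _ := by
        rw [Finset.mul_sum]; exact Finset.sum_congr rfl fun i _ => by simp; ring
  have hlam0 : 0 ≤ lam k := by
    rw [hlam, hL, lap_form A hA]
    refine mul_nonneg (by norm_num) (Finset.sum_nonneg fun i _ => Finset.sum_nonneg fun j _ => ?_)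
    exact mul_nonneg (hAnonneg i j) (mul_self_nonneg _)
  rcases hlam0.eq_or_lt with h | h
  · have hconst := lap_null A hA hAnonneg hconn (b k) (by rw [← hL, ← hlam, ← h])
    have hc : c k = 0 := by
      obtain ⟨i0⟩ := hconn.nonempty
      simp only [c]
      calc _ = ∑ i, y i * b k i0 := Finset.sum_congr rfl fun i _ => by rw [hconst i i0]
        _ = 0 := by rw [← Finset.sum_mul, hy, zero_mul]
    rw [hc]; simp
  · exact mul_le_mul_of_nonneg_right (hρ _ h ⟨b k, hbne, hb k⟩) (mul_self_nonneg _)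

lemma exp_decay (f f' : ℝ → ℝ) (k : ℝ) (hf : ∀ t, 0 ≤ t → HasDerivAt f (f' t) t)
    (hle : ∀ t, 0 ≤ t → f' t ≤ -k * f t) (t : ℝ) (ht : 0 ≤ t) :
    f t ≤ f 0 * Real.exp (-k * t) := by
  have hd : ∀ s, 0 ≤ s → HasDerivAt (fun s => f s * Real.exp (k * s))
      (f' s * Real.exp (k * s) + f s * (Real.exp (k * s) * (k * 1))) s := fun s hs =>
    (hf s hs).mul ((hasDerivAt_id s).const_mul k).exp
  have hanti : AntitoneOn (fun s => f s * Real.exp (k * s)) (Set.Ici 0) := by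
    refine antitoneOn_of_deriv_nonpos (convex_Ici 0)
      (fun s hs => (hd s hs).continuousAt.continuousWithinAt)
      (fun s hs => ?_) (fun s hs => ?_)
    · rw [interior_Ici] at hs
      exact (hd s (le_of_lt hs)).differentiableAt.differentiableWithinAt
    · rw [interior_Ici] at hs
      rw [(hd s (le_of_lt hs)).deriv]
      have := hle s (le_of_lt hs)
      have he := Real.exp_pos (k * s)
      nlinarith
  have h := hanti (Set.mem_Ici.2 le_rfl) (Set.mem_Ici.2 ht) ht
  simp only [mul_zero, Real.exp_zero, mul_one] at h
  have he := Real.exp_pos (-k * t)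
  calc f t = f t * Real.exp (k * t) * Real.exp (-k * t) := by
        rw [mul_assoc, ← Real.exp_add]; simp
    _ ≤ _ := mul_le_mul_of_nonneg_right h he.le



/-- consensus part of Theorem 1: under the dynamic triggering law,
with `W(t) = V(t) + Σᵢ ηᵢ(t)`, `k_d = minᵢ(βᵢ − (1 − ξᵢ)/θᵢ) > 0` and
`k_W = min{(1 − σ_max)ρ₂(L), k_d} > 0`, one has
`V(t) < W(t) ≤ W(0) e^{−k_W t}`. -/
theorem dynamic_trigger_exponential_consensus
    (n : ℕ) (hn : 2 ≤ n)
    (A : Matrix (Fin n) (Fin n) ℝ)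
    (hAsymm : A.IsSymm)
    (hAnonneg : ∀ i j, 0 ≤ A i j)
    (hAdiag : ∀ i, A i i = 0)
    (hconn : (SimpleGraph.fromRel (fun i j => 0 < A i j)).Connected)
    (L : Matrix (Fin n) (Fin n) ℝ)
    (hL : L = Matrix.diagonal (fun i => ∑ j, A i j) - A)
    (ρ₂ : ℝ)
    (hρ₂ : IsLeast {μ : ℝ | 0 < μ ∧ ∃ v : Fin n → ℝ, v ≠ 0 ∧ L.mulVec v = μ • v} ρ₂)
    (β ξ σ θ : Fin n → ℝ)
    (hβ : ∀ i, 0 < β i)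
    (hξ : ∀ i, ξ i ∈ Set.Icc (0 : ℝ) 1)
    (hσ : ∀ i, σ i ∈ Set.Ico (0 : ℝ) 1)
    (hθ : ∀ i, 0 < θ i ∧ (1 - ξ i) / β i < θ i)
    (σmax : ℝ) (hσmax : IsGreatest (Set.range σ) σmax)
    (x e : ℝ → Fin n → ℝ) (η : ℝ → Fin n → ℝ)
    (q : ℝ → Fin n → ℝ)
    (hq : ∀ t i, q t i = -(1/2) * ∑ j, L i j * (x t j - x t i)^2)
    (hx : ∀ t : ℝ, 0 ≤ t → HasDerivAt x (-(L.mulVec (x t + e t))) t)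
    (hηderiv : ∀ t : ℝ, 0 ≤ t → ∀ i,
      HasDerivAt (fun τ => η τ i) (-(β i) * η t i + ξ i * (σ i / 2 * q t i - L i i * (e t i)^2)) t)
    (hη0 : ∀ i, 0 < η 0 i)
    (htrig : ∀ t : ℝ, 0 ≤ t → ∀ i, θ i * (L i i * (e t i)^2 - σ i / 2 * q t i) ≤ η t i)
    (xbar : ℝ) (hxbar : xbar = (1 / (n : ℝ)) * ∑ i, x 0 i)
    (V W : ℝ → ℝ)
    (hV : ∀ t, V t = (1/2) * ∑ i, (x t i - xbar)^2)
    (hW : ∀ t, W t = V t + ∑ i, η t i)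
    (kd : ℝ) (hkd : IsLeast (Set.range fun i => β i - (1 - ξ i) / θ i) kd)
    (kW : ℝ) (hkW : kW = min ((1 - σmax) * ρ₂) kd) :
    0 < kd ∧ 0 < kW ∧
    ∀ t : ℝ, 0 ≤ t → V t < W t ∧ W t ≤ W 0 * Real.exp (-kW * t) := by

  obtain ⟨⟨hρpos, -⟩, hρmin⟩ := hρ₂
  have hkdpos : 0 < kd := by
    obtain ⟨⟨i, hi⟩, -⟩ := hkd
    have h1 := (hθ i).2
    rw [div_lt_iff₀ (hβ i)] at h1
    have h2 : (1 - ξ i) / θ i < β i := by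
      rw [div_lt_iff₀ (hθ i).1]; linarith
    simp only at hi
    linarith
  have hσ1 : σmax < 1 := by
    obtain ⟨⟨i, hi⟩, -⟩ := hσmax
    rw [← hi]; exact (hσ i).2
  have hkWpos : 0 < kW := by
    rw [hkW]; exact lt_min (mul_pos (by linarith) hρpos) hkdpos
  refine ⟨hkdpos, hkWpos, ?_⟩
  have hηpos : ∀ t, 0 ≤ t → ∀ i, 0 < η t i := by
    intro t ht i
    have := exp_decay (fun s => -η s i) _ (β i + ξ i / θ i) (fun s hs => (hηderiv s hs i).neg)
      (fun s hs => by
        have h1 := htrig s hs i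
        have h2 : L i i * (e s i)^2 - σ i / 2 * q s i ≤ η s i / θ i := by
          rw [le_div_iff₀ (hθ i).1]; linarith
        have h3 := mul_le_mul_of_nonneg_left h2 (hξ i).1
        have h4 : ξ i * (η s i / θ i) = ξ i / θ i * η s i := by ring
        nlinarith) t ht
    have h5 := mul_pos (hη0 i) (Real.exp_pos (-(β i + ξ i / θ i) * t))
    linarith
  have hLsymm1 : ∀ u : Fin n → ℝ, ∑ i, (L.mulVec u) i = 0 := by
    intro u
    have := lap_form A hAsymm (fun _ => 1) u
    rw [← hL] at this
    simpa using this
  have hxi : ∀ t, 0 ≤ t → ∀ i, HasDerivAt (fun s => x s i) (-(L.mulVec (x t + e t)) i) t := by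
    intro t ht i
    exact (hasDerivAt_pi.1 (hx t ht)) i
  have hn0 : (n : ℝ) ≠ 0 := by
    have : n ≠ 0 := by omega
    exact_mod_cast this
  have hsum : ∀ t, 0 ≤ t → ∑ i, (x t i - xbar) = 0 := by
    intro t ht
    have hd : ∀ s, 0 ≤ s → HasDerivAt (fun s => ∑ i, x s i) 0 s := by
      intro s hs
      have := HasDerivAt.fun_sum (u := Finset.univ) (fun i _ => hxi s hs i)
      rwa [Finset.sum_neg_distrib, hLsymm1, neg_zero] at this
    have h1 := exp_decay _ _ 0 hd (fun s hs => by simp) t ht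
    have h2 := exp_decay _ _ 0 (fun s hs => (hd s hs).neg) (fun s hs => by simp) t ht
    simp at h1 h2
    have h3 : ∑ i, x t i = ∑ i, x 0 i := le_antisymm h1 h2
    rw [Finset.sum_sub_distrib, h3, hxbar]
    simp
    field_simp
    ring
  have hLoff : ∀ i j, i ≠ j → L i j = - A i j := by
    intro i j hij
    rw [hL]; simp [Matrix.diagonal_apply_ne _ hij]
  have hLdiag : ∀ i, L i i = ∑ j, A i j := by
    intro i
    rw [hL]; simp [hAdiag]
  have hqA : ∀ t i, q t i = (1/2) * ∑ j, A i j * (x t j - x t i)^2 := by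
    intro t i
    rw [hq, neg_mul, ← mul_neg, ← Finset.sum_neg_distrib]
    congr 1
    refine Finset.sum_congr rfl fun j _ => ?_
    by_cases h : i = j
    · subst h; simp
    · rw [hLoff i j h]; ring
  have hqnn : ∀ t i, 0 ≤ q t i := by
    intro t i
    rw [hqA]
    exact mul_nonneg (by norm_num) (Finset.sum_nonneg fun j _ => mul_nonneg (hAnonneg i j) (sq_nonneg _))
  have hV' : ∀ t, 0 ≤ t → HasDerivAt V (- ∑ i, (x t i - xbar) * (L.mulVec (x t + e t)) i) t := by
    intro t ht
    have hVf : V = fun t => (1/2) * ∑ i, (x t i - xbar)^2 := funext hV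
    rw [hVf]
    have := (HasDerivAt.fun_sum (u := Finset.univ)
      (fun i _ => ((hxi t ht i).sub_const xbar).fun_pow 2)).const_mul (1/2 : ℝ)
    refine this.congr_deriv ?_
    rw [Finset.mul_sum, ← Finset.sum_neg_distrib]
    exact Finset.sum_congr rfl fun i _ => by simp; ring
  have hW' : ∀ t, 0 ≤ t → HasDerivAt W (- ∑ i, (x t i - xbar) * (L.mulVec (x t + e t)) i
      + ∑ i, (-(β i) * η t i + ξ i * (σ i / 2 * q t i - L i i * (e t i)^2))) t := by
    intro t ht
    have hWf : W = fun t => V t + ∑ i, η t i := funext hW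
    rw [hWf]
    exact (hV' t ht).add (HasDerivAt.fun_sum (fun i _ => hηderiv t ht i))
  -- the estimate of the derivative
  have hVle : ∀ t, - ∑ i, (x t i - xbar) * (L.mulVec (x t + e t)) i
      ≤ ∑ i, (L i i * (e t i)^2 - (1/2) * q t i) := by
    intro t
    have h1 : ∑ i, (x t i - xbar) * (L.mulVec (x t + e t)) i
        = ∑ i, (x t i + e t i) * (L.mulVec (x t)) i := by
      have ha := lap_form A hAsymm (fun i => x t i - xbar) (x t + e t)
      have hb := lap_form A hAsymm (x t + e t) (x t)
      rw [← hL] at ha hb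
      simp only [Pi.add_apply] at ha hb
      rw [ha, hb]
      congr 1
      exact Finset.sum_congr rfl fun i _ => Finset.sum_congr rfl fun j _ => by ring
    have h2 : ∑ i, x t i * (L.mulVec (x t)) i = ∑ i, q t i := by
      have ha := lap_form A hAsymm (x t) (x t)
      rw [← hL] at ha
      rw [ha, Finset.mul_sum]
      refine Finset.sum_congr rfl fun i _ => ?_
      rw [hqA]; congr 1
      exact Finset.sum_congr rfl fun j _ => by ring
    have h3 : - ∑ i, e t i * (L.mulVec (x t)) i ≤ ∑ i, (L i i * (e t i)^2 + (1/2) * q t i) := by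
      rw [← Finset.sum_neg_distrib]
      refine Finset.sum_le_sum fun i _ => ?_
      rw [hL, lap_mulVec, ← hL, hLdiag, hqA, Finset.mul_sum, ← Finset.sum_neg_distrib,
        Finset.sum_mul, Finset.mul_sum, Finset.mul_sum, ← Finset.sum_add_distrib]
      refine Finset.sum_le_sum fun j _ => ?_
      have := mul_nonneg (hAnonneg i j) (sq_nonneg (e t i - (1/2) * (x t j - x t i)))
      nlinarith
    rw [h1]
    simp only [add_mul, Finset.sum_add_distrib, Finset.sum_sub_distrib, ← Finset.mul_sum] at h3 ⊢
    linarith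
  have hgap : ∀ t, 0 ≤ t → 2 * ρ₂ * V t ≤ ∑ i, q t i := by
    intro t ht
    have h := lap_gap A hAsymm hAnonneg hconn L hL ρ₂ (fun μ h1 h2 => hρmin ⟨h1, h2⟩)
      (fun i => x t i - xbar) (hsum t ht)
    have ha := lap_form A hAsymm (fun i => x t i - xbar) (fun i => x t i - xbar)
    rw [← hL] at ha
    have hb : ∑ i, q t i = (1/2) * ∑ i, ∑ j, A i j * ((x t i - xbar - (x t j - xbar)) *
        (x t i - xbar - (x t j - xbar))) := by
      rw [Finset.mul_sum]
      refine Finset.sum_congr rfl fun i _ => ?_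
      rw [hqA]; congr 1
      exact Finset.sum_congr rfl fun j _ => by ring
    rw [hb, ← ha, hV]
    linarith
  have hVnn : ∀ t, 0 ≤ V t := fun t => by
    rw [hV]; exact mul_nonneg (by norm_num) (Finset.sum_nonneg fun i _ => sq_nonneg _)
  intro t ht
  constructor
  · rw [hW]
    have : 0 < ∑ i, η t i :=
      Finset.sum_pos (fun i _ => hηpos t ht i) ⟨⟨0, by omega⟩, Finset.mem_univ _⟩
    linarith
  · refine exp_decay W _ kW hW' (fun s hs => ?_) t ht
    have hterm : ∑ i, (L i i * (e s i)^2 - (1/2) * q s i)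
        + ∑ i, (-(β i) * η s i + ξ i * (σ i / 2 * q s i - L i i * (e s i)^2))
        ≤ ∑ i, (-((1 - σmax) / 2) * q s i + -kd * η s i) := by
      rw [← Finset.sum_add_distrib]
      refine Finset.sum_le_sum fun i _ => ?_
      have h1 : L i i * (e s i)^2 - σ i / 2 * q s i ≤ η s i / θ i := by
        rw [le_div_iff₀ (hθ i).1]; linarith [htrig s hs i]
      have h2 := mul_le_mul_of_nonneg_left h1 (sub_nonneg.2 (hξ i).2)
      have h3 : (1 - ξ i) * (η s i / θ i) = (1 - ξ i) / θ i * η s i := by ring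
      have h4 : kd ≤ β i - (1 - ξ i) / θ i := hkd.2 ⟨i, rfl⟩
      have h5 := mul_le_mul_of_nonneg_right h4 (hηpos s hs i).le
      have h6 : σ i ≤ σmax := hσmax.2 ⟨i, rfl⟩
      have h7 := mul_le_mul_of_nonneg_right h6 (hqnn s i)
      linarith
    have hsplit : ∑ i, (-((1 - σmax) / 2) * q s i + -kd * η s i)
        = -((1 - σmax) / 2) * ∑ i, q s i + -kd * ∑ i, η s i := by
      rw [Finset.sum_add_distrib, ← Finset.mul_sum, ← Finset.mul_sum]
    rw [hsplit] at hterm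
    have hg := mul_le_mul_of_nonneg_left (hgap s hs) (by linarith : 0 ≤ (1 - σmax) / 2)
    have hk1 : kW ≤ (1 - σmax) * ρ₂ := by rw [hkW]; exact min_le_left _ _
    have hk2 : kW ≤ kd := by rw [hkW]; exact min_le_right _ _
    have hm1 := mul_le_mul_of_nonneg_right hk1 (hVnn s)
    have hm2 := mul_le_mul_of_nonneg_right hk2
      (Finset.sum_nonneg fun i (_ : i ∈ Finset.univ) => (hηpos s hs i).le)
    have := hVle s
    rw [hW s]
    linarith
end

section
/- (Inter-event time lower bound used to exclude Zeno behavior in Theorem 1.) Let β > 0, ξ ∈ [0,1], θ > 0, ℓ > 0 (the diagonal Laplacian entry Lᵢᵢ), M₀ > 0, and η₀ > 0. Let 0 ≤ t₁ ≤ t₂ and let e : [t₁,t₂] → ℝ be differentiable with e(t₁) = 0 and |e′(t)| ≤ 2M₀ℓ for all t ∈ [t₁,t₂]. If θ ℓ e(t₂)² ≥ η₀ e^{−(β + ξ/θ) t₂}, then t₂ − t₁ ≥ (1/(2M₀ℓ)) √(η₀/(θℓ)) · e^{−(1/2)(β + ξ/θ) t₂}. In particular, on any bounded time interval the distance between consecutive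 event times of agent i is bounded below by a positive constant, so the triggering time sequence exhibits no Zeno behavior. -/
/-- inter-event time bound excluding Zeno behavior in Theorem 1:
if the measurement error `e` resets to `0` at `t₁`, has derivative bounded by
`2M₀ℓ` on `[t₁, t₂]`, and a new event occurs at `t₂`, i.e.
`θ ℓ e(t₂)² ≥ η₀ e^{−(β + ξ/θ) t₂}`, then
`t₂ − t₁ ≥ (1/(2M₀ℓ)) √(η₀/(θℓ)) e^{−(1/2)(β + ξ/θ) t₂}`. -/
theorem inter_event_time_lower_bound
    (β ξ θ ℓ M₀ η₀ : ℝ)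
    (hβ : 0 < β) (hξ : ξ ∈ Set.Icc (0 : ℝ) 1) (hθ : 0 < θ)
    (hℓ : 0 < ℓ) (hM₀ : 0 < M₀) (hη₀ : 0 < η₀)
    (t₁ t₂ : ℝ) (ht₁ : 0 ≤ t₁) (ht₁₂ : t₁ ≤ t₂)
    (e e' : ℝ → ℝ)
    (he₁ : e t₁ = 0)
    (hderiv : ∀ t ∈ Set.Icc t₁ t₂, HasDerivAt e (e' t) t)
    (hbound : ∀ t ∈ Set.Icc t₁ t₂, |e' t| ≤ 2 * M₀ * ℓ)
    (htrig : η₀ * Real.exp (-(β + ξ / θ) * t₂) ≤ θ * ℓ * (e t₂)^2) :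
    (1 / (2 * M₀ * ℓ)) * Real.sqrt (η₀ / (θ * ℓ)) *
      Real.exp (-(1/2) * (β + ξ / θ) * t₂) ≤ t₂ - t₁ := by
  have hK : 0 < 2 * M₀ * ℓ := by positivity
  have hθℓ : 0 < θ * ℓ := by positivity
  have h1 : |e t₂| ≤ 2 * M₀ * ℓ * (t₂ - t₁) := by
    have h := (convex_Icc t₁ t₂).norm_image_sub_le_of_norm_hasDerivWithin_le
      (fun t ht => (hderiv t ht).hasDerivWithinAt) (fun t ht => hbound t ht)
      (Set.left_mem_Icc.2 ht₁₂) (Set.right_mem_Icc.2 ht₁₂)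
    rw [he₁, sub_zero, Real.norm_eq_abs, Real.norm_eq_abs,
      abs_of_nonneg (sub_nonneg.2 ht₁₂)] at h
    exact h
  have h2 : Real.sqrt (η₀ / (θ * ℓ)) * Real.exp (-(1/2) * (β + ξ / θ) * t₂) ≤ |e t₂| := by
    apply abs_le_of_sq_le_sq' _ (abs_nonneg _) |>.2
    rw [mul_pow, Real.sq_sqrt (by positivity), sq_abs, ← Real.exp_nat_mul, div_mul_eq_mul_div,
      div_le_iff₀ hθℓ]
    have h3 : ((2 : ℕ) : ℝ) * (-(1/2) * (β + ξ / θ) * t₂) = -(β + ξ / θ) * t₂ := by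
      push_cast
      ring
    rw [h3]
    linarith
  rw [mul_assoc, one_div, inv_mul_le_iff₀ hK]
  exact h2.trans h1
end

section
/- Let L be the Laplacian matrix of a weighted undirected graph on n vertices. For all x̂, e ∈ ℝⁿ, setting x = x̂ − e, one has −xᵀL x̂ ≤ −(1/2) Σᵢ₌₁ⁿ q̂ᵢ(x̂) + Σᵢ₌₁ⁿ Lᵢᵢ eᵢ², where q̂ᵢ(x̂) = −(1/2) Σⱼ₌₁ⁿ Lᵢⱼ (x̂ⱼ − x̂ᵢ)². -/
open Matrix BigOperators

/-- Key estimate (21) in the discontinuous approach: with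
`x = x̂ − e`, `−xᵀL x̂ ≤ −(1/2) Σᵢ q̂ᵢ(x̂) + Σᵢ Lᵢᵢ eᵢ²` where
`q̂ᵢ(x̂) = −(1/2) Σⱼ Lᵢⱼ (x̂ⱼ − x̂ᵢ)²`. -/
theorem dV_upper_bound_discontinuous
    (n : ℕ) (hn : 1 ≤ n)
    (A : Matrix (Fin n) (Fin n) ℝ)
    (hAsymm : A.IsSymm)
    (hAnonneg : ∀ i j, 0 ≤ A i j)
    (hAdiag : ∀ i, A i i = 0)
    (L : Matrix (Fin n) (Fin n) ℝ)
    (hL : L = Matrix.diagonal (fun i => ∑ j, A i j) - A)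
    (xhat e : Fin n → ℝ)
    (qhat : Fin n → ℝ)
    (hqhat : ∀ i, qhat i = -(1/2) * ∑ j, L i j * (xhat j - xhat i)^2) :
    -((xhat - e) ⬝ᵥ L.mulVec xhat) ≤ -(1/2) * ∑ i, qhat i + ∑ i, L i i * (e i)^2 := by
  have hLii : ∀ i, L i i = ∑ j, A i j := by
    intro i
    simp [hL, hAdiag]
  have hLx : ∀ i, L.mulVec xhat i = ∑ j, A i j * (xhat i - xhat j) := by
    intro i
    rw [hL, Matrix.sub_mulVec, Pi.sub_apply, Matrix.mulVec_diagonal, Finset.sum_mul]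
    simp only [Matrix.mulVec, dotProduct]
    rw [← Finset.sum_sub_distrib]
    exact Finset.sum_congr rfl fun j _ => by ring
  have hq : ∀ i, qhat i = ∑ j, 1 / 2 * (A i j * (xhat j - xhat i) ^ 2) := by
    intro i
    rw [hqhat, Finset.mul_sum]
    refine Finset.sum_congr rfl fun j _ => ?_
    by_cases h : i = j
    · subst h
      simp
    · simp [hL, Matrix.diagonal_apply_ne _ h]
  have hsw : ∑ i, ∑ j, A i j * (xhat i * (xhat i - xhat j))
      = ∑ i, ∑ j, A i j * (xhat j * (xhat j - xhat i)) := by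
    rw [Finset.sum_comm]
    refine Finset.sum_congr rfl fun i _ => Finset.sum_congr rfl fun j _ => ?_
    rw [hAsymm.apply]
  have h1 : (xhat - e) ⬝ᵥ L.mulVec xhat
      = ∑ i, ∑ j, A i j * ((xhat i - e i) * (xhat i - xhat j)) := by
    simp only [dotProduct, hLx, Pi.sub_apply, Finset.mul_sum]
    exact Finset.sum_congr rfl fun i _ => Finset.sum_congr rfl fun j _ => by ring
  have key : 0 ≤ ∑ i, ∑ j, (A i j * ((xhat i - e i) * (xhat i - xhat j))
      - 1 / 2 * (1 / 2 * (A i j * (xhat j - xhat i) ^ 2)) + A i j * e i ^ 2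
      - 1 / 2 * (A i j * (xhat i * (xhat i - xhat j)))
      + 1 / 2 * (A i j * (xhat j * (xhat j - xhat i)))) := by
    refine Finset.sum_nonneg fun i _ => Finset.sum_nonneg fun j _ => ?_
    have := mul_nonneg (hAnonneg i j) (sq_nonneg ((xhat i - xhat j) / 2 - e i))
    nlinarith [this]
  simp only [Finset.sum_add_distrib, Finset.sum_sub_distrib, ← Finset.mul_sum] at key
  rw [h1]
  simp only [hq, hLii, Finset.sum_mul, ← Finset.mul_sum] at *
  linarith
end

section
/- Let L be the Laplacian matrix of a connected weighted undirected graph on n ≥ 2 vertices. Let σ₁,…,σₙ ∈ [0,1) with σ_max = maxᵢ σᵢ, θ₁,…,θₙ > 0, and χ₁,…,χₙ > 0. If x̂, e ∈ ℝⁿ satisfy θᵢ(Lᵢᵢ eᵢ² − (σᵢ/2) q̂ᵢ(x̂)) ≤ χᵢ for every i, where q̂ᵢ(x̂) = −(1/2) Σⱼ Lᵢⱼ (x̂ⱼ − x̂ᵢ)², then with x = x̂ − e one has xᵀLx ≤ (2 + ‖L‖σ_max / minᵢ Lᵢᵢ) · x̂ᵀLx̂ + (2‖L‖ / minᵢ{θᵢLᵢᵢ})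 · Σᵢ₌₁ⁿ χᵢ. -/
open Matrix BigOperators

lemma aux_quad {n : ℕ} (A : Matrix (Fin n) (Fin n) ℝ) (hA : A.IsSymm) (v : Fin n → ℝ) :
    v ⬝ᵥ (Matrix.diagonal (fun i => ∑ j, A i j) - A).mulVec v =
      ∑ i, (1/2) * ∑ j, A i j * (v j - v i)^2 := by
  have h1 : v ⬝ᵥ (Matrix.diagonal (fun i => ∑ j, A i j) - A).mulVec v =
      ∑ i, ∑ j, A i j * (v i ^ 2 - v i * v j) := by
    rw [Matrix.sub_mulVec, dotProduct_sub]
    simp only [dotProduct, Matrix.mulVec_diagonal]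
    simp only [Matrix.mulVec, dotProduct]
    rw [← Finset.sum_sub_distrib]
    refine Finset.sum_congr rfl fun i _ => ?_
    rw [Finset.mul_sum, Finset.sum_mul, Finset.mul_sum, ← Finset.sum_sub_distrib]
    refine Finset.sum_congr rfl fun j _ => ?_
    ring
  have h2 : ∑ i, ∑ j, A i j * (v i ^ 2 - v i * v j) =
      ∑ i, ∑ j, A i j * (v j ^ 2 - v i * v j) := by
    rw [Finset.sum_comm]
    refine Finset.sum_congr rfl fun i _ => Finset.sum_congr rfl fun j _ => ?_
    rw [hA.apply i j]; ring
  have h3 : ∑ i, (1/2) * ∑ j, A i j * (v j - v i)^2 = (1/2) *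
      (∑ i, ∑ j, A i j * (v i ^ 2 - v i * v j) + ∑ i, ∑ j, A i j * (v j ^ 2 - v i * v j)) := by
    rw [← Finset.mul_sum, ← Finset.sum_add_distrib]
    congr 1
    refine Finset.sum_congr rfl fun i _ => ?_
    rw [← Finset.sum_add_distrib]
    refine Finset.sum_congr rfl fun j _ => ?_
    ring
  rw [h3, ← h2, h1]; ring

lemma aux_norm {n : ℕ} (L : Matrix (Fin n) (Fin n) ℝ) (e : Fin n → ℝ) :
    e ⬝ᵥ L.mulVec e ≤ ‖(Matrix.toEuclideanCLM (𝕜 := ℝ) L :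
      EuclideanSpace ℝ (Fin n) →L[ℝ] EuclideanSpace ℝ (Fin n))‖ * ∑ i, e i ^ 2 := by
  set T := (Matrix.toEuclideanCLM (𝕜 := ℝ) L :
      EuclideanSpace ℝ (Fin n) →L[ℝ] EuclideanSpace ℝ (Fin n))
  set w : EuclideanSpace ℝ (Fin n) := WithLp.toLp 2 e
  have h1 : e ⬝ᵥ L.mulVec e = inner ℝ (T w) w := by
    rw [PiLp.inner_apply]
    simp [T, w, dotProduct, Matrix.toEuclideanCLM_toLp]
  have h2 : ∑ i, e i ^ 2 = ‖w‖ ^ 2 := by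
    rw [EuclideanSpace.norm_sq_eq]; simp [w]
  rw [h1, h2]
  calc _ ≤ ‖T w‖ * ‖w‖ := real_inner_le_norm _ _
    _ ≤ (‖T‖ * ‖w‖) * ‖w‖ := by gcongr; exact T.le_opNorm w
    _ = _ := by ring

/-- inequality (30): under the dynamic triggering condition
`θᵢ(Lᵢᵢ eᵢ² − (σᵢ/2) q̂ᵢ(x̂)) ≤ χᵢ`, with `x = x̂ − e` one has
`xᵀLx ≤ (2 + ‖L‖σ_max / minᵢ Lᵢᵢ) x̂ᵀLx̂ + (2‖L‖ / minᵢ{θᵢLᵢᵢ}) Σᵢ χᵢ`. -/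
theorem quadform_bound_dynamic_discontinuous
    (n : ℕ) (hn : 2 ≤ n)
    (A : Matrix (Fin n) (Fin n) ℝ)
    (hAsymm : A.IsSymm)
    (hAnonneg : ∀ i j, 0 ≤ A i j)
    (hAdiag : ∀ i, A i i = 0)
    (hconn : (SimpleGraph.fromRel (fun i j => 0 < A i j)).Connected)
    (L : Matrix (Fin n) (Fin n) ℝ)
    (hL : L = Matrix.diagonal (fun i => ∑ j, A i j) - A)
    (σ : Fin n → ℝ) (hσ : ∀ i, σ i ∈ Set.Ico (0 : ℝ) 1)
    (σmax : ℝ) (hσmax : IsGreatest (Set.range σ) σmax)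
    (θ : Fin n → ℝ) (hθ : ∀ i, 0 < θ i)
    (χ : Fin n → ℝ) (hχ : ∀ i, 0 < χ i)
    (normL : ℝ)
    (hnormL : normL = ‖(Matrix.toEuclideanCLM (𝕜 := ℝ) L :
      EuclideanSpace ℝ (Fin n) →L[ℝ] EuclideanSpace ℝ (Fin n))‖)
    (m : ℝ) (hm : IsLeast (Set.range fun i => L i i) m)
    (mθ : ℝ) (hmθ : IsLeast (Set.range fun i => θ i * L i i) mθ)
    (xhat e : Fin n → ℝ)
    (qhat : Fin n → ℝ)
    (hqhat : ∀ i, qhat i = -(1/2) * ∑ j, L i j * (xhat j - xhat i)^2)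
    (htrig : ∀ i, θ i * (L i i * (e i)^2 - σ i / 2 * qhat i) ≤ χ i) :
    (xhat - e) ⬝ᵥ L.mulVec (xhat - e) ≤
      (2 + normL * σmax / m) * (xhat ⬝ᵥ L.mulVec xhat) + (2 * normL / mθ) * ∑ i, χ i := by
  have hnt : Nontrivial (Fin n) := Fin.nontrivial_iff_two_le.mpr hn
  have hLii : ∀ i, L i i = ∑ j, A i j := by intro i; simp [hL, hAdiag]
  have hLpos : ∀ i, 0 < L i i := by
    intro i
    obtain ⟨j, hj⟩ := hconn.preconnected.exists_adj_of_nontrivial i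
    have hj' : 0 < A i j := by
      rw [SimpleGraph.fromRel_adj] at hj
      rcases hj.2 with h | h
      · exact h
      · rwa [hAsymm.apply] at h
    rw [hLii]
    exact Finset.sum_pos' (fun k _ => hAnonneg i k) ⟨j, Finset.mem_univ j, hj'⟩
  have hq : ∀ i, qhat i = (1/2) * ∑ j, A i j * (xhat j - xhat i)^2 := by
    intro i
    have : ∑ j, L i j * (xhat j - xhat i)^2 = - ∑ j, A i j * (xhat j - xhat i)^2 := by
      rw [← Finset.sum_neg_distrib]
      refine Finset.sum_congr rfl fun j _ => ?_
      by_cases h : i = j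
      · subst h; simp
      · simp [hL, Matrix.diagonal_apply_ne _ h]
    rw [hqhat, this]; ring
  have hq0 : ∀ i, 0 ≤ qhat i := by
    intro i; rw [hq]
    have : 0 ≤ ∑ j, A i j * (xhat j - xhat i)^2 :=
      Finset.sum_nonneg fun j _ => mul_nonneg (hAnonneg i j) (sq_nonneg _)
    linarith
  have hpsd : ∀ v : Fin n → ℝ, 0 ≤ v ⬝ᵥ L.mulVec v := by
    intro v
    rw [hL, aux_quad A hAsymm]
    refine Finset.sum_nonneg fun i _ => mul_nonneg (by norm_num) ?_
    exact Finset.sum_nonneg fun j _ => mul_nonneg (hAnonneg i j) (sq_nonneg _)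
  have hQ : xhat ⬝ᵥ L.mulVec xhat = ∑ i, qhat i := by
    rw [hL, aux_quad A hAsymm]
    exact Finset.sum_congr rfl fun i _ => (hq i).symm
  have hmpos : 0 < m := by obtain ⟨i, hi⟩ := hm.1; rw [← hi]; exact hLpos i
  have hmθpos : 0 < mθ := by
    obtain ⟨i, hi⟩ := hmθ.1; rw [← hi]; exact mul_pos (hθ i) (hLpos i)
  have hN : 0 ≤ normL := by rw [hnormL]; exact norm_nonneg _
  have he : ∀ i, e i ^ 2 ≤ σmax / (2 * m) * qhat i + χ i / mθ := by
    intro i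
    have hl := hLpos i
    have h1 : m ≤ L i i := hm.2 ⟨i, rfl⟩
    have h2 : mθ ≤ θ i * L i i := hmθ.2 ⟨i, rfl⟩
    have h3 : σ i ≤ σmax := hσmax.2 ⟨i, rfl⟩
    have h0 := (hσ i).1
    have hqi := hq0 i
    have ht := hθ i
    have hc := hχ i
    have h4 : e i ^ 2 ≤ σ i / (2 * L i i) * qhat i + χ i / (θ i * L i i) := by
      have : σ i / (2 * L i i) * qhat i + χ i / (θ i * L i i) - e i ^ 2 =
          (χ i - θ i * (L i i * (e i)^2 - σ i / 2 * qhat i)) / (θ i * L i i) := by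
        field_simp
        ring
      have h5 := div_nonneg (sub_nonneg.2 (htrig i)) (mul_pos ht hl).le
      linarith
    refine h4.trans ?_
    have hs : 0 ≤ σmax := h0.trans h3
    gcongr
  have hsum : ∑ i, e i ^ 2 ≤ σmax / (2 * m) * (∑ i, qhat i) + (∑ i, χ i) / mθ := by
    rw [Finset.mul_sum, Finset.sum_div, ← Finset.sum_add_distrib]
    exact Finset.sum_le_sum fun i _ => he i
  have hpar : (xhat - e) ⬝ᵥ L.mulVec (xhat - e) + (xhat + e) ⬝ᵥ L.mulVec (xhat + e) =
      2 * (xhat ⬝ᵥ L.mulVec xhat) + 2 * (e ⬝ᵥ L.mulVec e) := by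
    simp only [Matrix.mulVec_sub, Matrix.mulVec_add, dotProduct_sub, dotProduct_add,
      sub_dotProduct, add_dotProduct]
    ring
  have hp := hpsd (xhat + e)
  have hne := aux_norm L e
  rw [← hnormL] at hne
  have hfin := mul_le_mul_of_nonneg_left hsum hN
  rw [hQ] at hpar ⊢
  have hEq : (2 + normL * σmax / m) * (∑ i, qhat i) + (2 * normL / mθ) * ∑ i, χ i =
      2 * (∑ i, qhat i) +
        2 * (normL * (σmax / (2 * m) * (∑ i, qhat i) + (∑ i, χ i) / mθ)) := by
    field_simp
    ring
  rw [hEq]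
  linarith
end
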